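/- Suppose E[S] = 1. Then for all integers k ≥ 1, all p ≥ 2, all t ∈ [0,1], and all θ > 0, E[|∑_{i=1}^k N_i(t) − k t|^p] ≤ exp(θ) (10^5 p^4 / (1 − E[exp(−θS)]))^{p+2} max(k t, (k t)^{p/2}). -/

import Mathlib

open MeasureTheory ProbabilityTheory
open scoped ENNReal

/-- The number of renewals in `[0, t]` of a renewal process whose successive renewal
intervals are `ξ 0, ξ 1, ξ 2, ...`. -/
noncomputable def renewalCount (ξ : ℕ → ℝ) (t : ℝ) : ℕ :=
  sSup {n : ℕ | ∑ i ∈ Finset.range n, ξ i ≤ t}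

namespace PCM

lemma indep_curry {Ω : Type*} [MeasurableSpace Ω] (μ : Measure Ω) [IsProbabilityMeasure μ]
    (ξ : ℕ → ℕ → Ω → ℝ) (hξmeas : ∀ i j, Measurable (ξ i j))
    (hindep : iIndepFun (fun q : ℕ × ℕ => ξ q.1 q.2) μ) :
    iIndepFun (fun i ω => fun j => ξ i j ω) μ := by
  have h2 : ∀ i, iIndepFun (ξ i) μ := fun i =>
    hindep.precomp (g := fun j : ℕ => (i, j)) (fun a b h => by simpa using h)
  have hp : ∀ i j, IsProbabilityMeasure (μ.map (ξ i j)) :=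
    fun i j ↦ Measure.isProbabilityMeasure_map (hξmeas i j).aemeasurable
  have hm : ∀ i, Measurable (fun ω => fun j => ξ i j ω) := fun i => by fun_prop
  have hcomp : (MeasurableEquiv.curry ℕ ℕ ℝ) ∘ (fun ω (q : ℕ × ℕ) ↦ ξ q.1 q.2 ω)
      = fun ω i j ↦ ξ i j ω := by
    ext; rfl
  rw [iIndepFun_iff_map_fun_eq_infinitePi_map hm]
  have e1 := (iIndepFun_iff_map_fun_eq_infinitePi_map
    (fun q : ℕ × ℕ => hξmeas q.1 q.2)).1 hindep
  have e2 := congrArg (fun m => Measure.map (MeasurableEquiv.curry ℕ ℕ ℝ) m) e1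
  rw [Measure.map_map (by fun_prop) (by fun_prop), hcomp,
    Measure.infinitePi_map_curry (fun i j => μ.map (ξ i j))] at e2
  rw [e2]
  congr 1
  funext i
  exact ((iIndepFun_iff_map_fun_eq_infinitePi_map (hξmeas i)).1 (h2 i)).symm

lemma measurable_renewalCount (t : ℝ) : Measurable (fun ξ : ℕ → ℝ => renewalCount ξ t) := by
  refine measurable_to_countable' fun m => ?_
  have hA : ∀ n : ℕ, MeasurableSet {ξ : ℕ → ℝ | ∑ i ∈ Finset.range n, ξ i ≤ t} := fun n =>
    measurableSet_le (by fun_prop) measurable_const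
  have hG : ∀ n : ℕ, MeasurableSet
      {ξ : ℕ → ℝ | IsGreatest {n : ℕ | ∑ i ∈ Finset.range n, ξ i ≤ t} n} := fun n => by
    have : {ξ : ℕ → ℝ | IsGreatest {n : ℕ | ∑ i ∈ Finset.range n, ξ i ≤ t} n}
      = {ξ : ℕ → ℝ | ∑ i ∈ Finset.range n, ξ i ≤ t} ∩
        ⋂ j : ℕ, ({ξ : ℕ → ℝ | ∑ i ∈ Finset.range j, ξ i ≤ t}ᶜ ∪ {ξ : ℕ → ℝ | j ≤ n}) := by
      ext ξ
      simp only [IsGreatest, upperBounds, Set.mem_ofPred_eq, Set.mem_inter_iff, Set.mem_iInter,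
        Set.mem_union, Set.mem_compl_iff]
      refine and_congr_right fun _ => forall_congr' fun j => ?_
      tauto
    rw [this]
    refine (hA n).inter (MeasurableSet.iInter fun j => ((hA j).compl).union (MeasurableSet.const _))
  have : (fun ξ : ℕ → ℝ => renewalCount ξ t) ⁻¹' {m} =
      {ξ : ℕ → ℝ | IsGreatest {n : ℕ | ∑ i ∈ Finset.range n, ξ i ≤ t} m} ∪
      ((⋃ n : ℕ, {ξ : ℕ → ℝ | IsGreatest {n : ℕ | ∑ i ∈ Finset.range n, ξ i ≤ t} n})ᶜ ∩
        {ξ : ℕ → ℝ | m = 0}) := by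
    ext ξ
    simp only [Set.mem_preimage, Set.mem_singleton_iff, Set.mem_union, Set.mem_ofPred_eq,
      Set.mem_inter_iff, Set.mem_compl_iff, Set.mem_iUnion, not_exists, renewalCount]
    by_cases h : ∃ n, IsGreatest {n : ℕ | ∑ i ∈ Finset.range n, ξ i ≤ t} n
    · obtain ⟨n, hn⟩ := h
      rw [hn.csSup_eq]
      constructor
      · rintro rfl; exact Or.inl hn
      · rintro (h | h)
        · exact hn.unique h
        · exact absurd hn (h.1 n)
    · have h0 : sSup {n : ℕ | ∑ i ∈ Finset.range n, ξ i ≤ t} = 0 := by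
        rcases Set.eq_empty_or_nonempty {n : ℕ | ∑ i ∈ Finset.range n, ξ i ≤ t} with he | hne
        · rw [he]; simp
        · by_cases hb : BddAbove {n : ℕ | ∑ i ∈ Finset.range n, ξ i ≤ t}
          · exact absurd ⟨_, Nat.sSup_mem hne hb, fun x hx => le_csSup hb hx⟩ h
          · rw [Nat.sSup_of_not_bddAbove hb]
      rw [h0]
      push Not at h
      constructor
      · intro hm; exact Or.inr ⟨h, hm.symm⟩
      · rintro (hh | hh)
        · exact absurd hh (h m)
        · exact hh.2.symm
  rw [this]
  exact (hG m).union (((MeasurableSet.iUnion hG).compl).inter (MeasurableSet.const _))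

lemma conv_Iic (τ ρ : Measure ℝ) [IsProbabilityMeasure τ] [IsProbabilityMeasure ρ] (t : ℝ) :
    (τ ∗ ρ) (Set.Iic t) = ∫⁻ w, ρ (Set.Iic (t - w)) ∂τ := by
  rw [← lintegral_indicator_one measurableSet_Iic, Measure.lintegral_conv
    (measurable_one.indicator measurableSet_Iic)]
  refine lintegral_congr fun w => ?_
  rw [← lintegral_indicator_one measurableSet_Iic]
  refine lintegral_congr fun y => ?_
  simp only [Set.indicator, Set.mem_Iic, le_sub_iff_add_le', Pi.one_apply]

lemma conv_key (ρ σ τ : Measure ℝ) [IsProbabilityMeasure ρ] [IsProbabilityMeasure σ]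
    [IsProbabilityMeasure τ] (hρ0 : ρ (Set.Iio 0) = 0) (hσ0 : σ (Set.Iio 0) = 0)
    (hτ0 : τ (Set.Iio 0) = 0)
    (hρ : ∀ u, 0 ≤ u → ρ (Set.Iic u) = ∫⁻ z in Set.Icc 0 u, σ (Set.Ioi z)) (t : ℝ) :
    (τ ∗ ρ) (Set.Iic t) + ∫⁻ x in Set.Icc 0 t, (τ ∗ σ) (Set.Iic x)
      = ∫⁻ x in Set.Icc 0 t, τ (Set.Iic x) := by
  have hmS : Measurable fun z : ℝ => σ (Set.Ioi z) :=
    Antitone.measurable fun a b h => measure_mono (Set.Ioi_subset_Ioi h)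
  have hmI : Measurable fun z : ℝ => σ (Set.Iic z) :=
    Monotone.measurable fun a b h => measure_mono (Set.Iic_subset_Iic.2 h)
  have hmg : Measurable fun q : ℝ × ℝ => (Set.Ici (0:ℝ)).indicator (fun z => σ (Set.Ioi z)) (q.1 - q.2) :=
    (hmS.indicator measurableSet_Ici).comp (measurable_fst.sub measurable_snd)
  have hτnn : ∀ᵐ w ∂τ, 0 ≤ w := by
    rw [ae_iff]; convert hτ0 using 2; ext; simp
  have h1 : (τ ∗ ρ) (Set.Iic t) = ∫⁻ x in Set.Icc 0 t, ∫⁻ w,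
      (Set.Ici (0:ℝ)).indicator (fun z => σ (Set.Ioi z)) (x - w) ∂τ := by
    rw [lintegral_lintegral_swap hmg.aemeasurable, conv_Iic]
    refine lintegral_congr_ae (hτnn.mono fun w hw => ?_)
    show ρ (Set.Iic (t - w)) = _
    have e : ∫⁻ x in Set.Icc 0 t, (Set.Ici (0:ℝ)).indicator (fun z => σ (Set.Ioi z)) (x - w)
        = ∫⁻ z in Set.Icc 0 (t - w), σ (Set.Ioi z) := by
      rw [← lintegral_indicator measurableSet_Icc, ← lintegral_indicator measurableSet_Icc,
        ← lintegral_sub_right_eq_self (fun z => (Set.Icc 0 (t - w)).indicator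
          (fun z => σ (Set.Ioi z)) z) w]
      refine lintegral_congr fun x => ?_
      simp only [Set.indicator, Set.mem_Icc, Set.mem_Ici]
      split_ifs <;> first | rfl | (exfalso; grind)
    refine Eq.trans ?_ e.symm
    rcases le_or_gt w t with h | h
    · exact hρ _ (by linarith)
    · rw [Set.Icc_eq_empty (by linarith)]
      simp only [Measure.restrict_empty, lintegral_zero_measure]
      exact measure_mono_null (fun x hx => by simp at hx ⊢; linarith) hρ0
  rw [h1, ← lintegral_add_left hmg.lintegral_prod_right']
  refine lintegral_congr fun x => ?_
  have hmx : Measurable fun w : ℝ => (Set.Ici (0:ℝ)).indicator (fun z => σ (Set.Ioi z)) (x - w) :=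
    hmg.comp measurable_prodMk_left
  rw [conv_Iic, ← lintegral_add_left hmx,
    ← lintegral_indicator_one measurableSet_Iic]
  refine lintegral_congr fun w => ?_
  simp only [Set.indicator, Set.mem_Ici, Set.mem_Iic, sub_nonneg, Pi.one_apply]
  split_ifs with h
  · rw [← Set.compl_Iic, add_comm, measure_add_measure_compl measurableSet_Iic, measure_univ]
  · rw [zero_add]
    exact measure_mono_null (fun y hy => by simp at hy ⊢; linarith) hσ0

section Single

variable {Ω : Type*} [MeasurableSpace Ω] {μ : Measure Ω} [IsProbabilityMeasure μ]
  {S : Ω → ℝ} {X : ℕ → Ω → ℝ}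

lemma law_zero (hSmeas : Measurable S) (hSnn : ∀ᵐ ω ∂μ, 0 ≤ S ω)
    (hES : ∫ ω, S ω ∂μ = 1) {R : Ω → ℝ} (hR : Measurable R)
    (heq : ∀ y : ℝ, 0 ≤ y →
      (μ {ω | y < R ω}).toReal = ∫ z in Set.Ioi y, (μ {ω | z < S ω}).toReal)
    (u : ℝ) (hu : 0 ≤ u) :
    μ.map R (Set.Iic u) = ∫⁻ z in Set.Icc 0 u, μ.map S (Set.Ioi z) := by
  have hi : Integrable S μ := by
    by_contra h
    rw [integral_undef h] at hES
    norm_num at hES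
  have hσ : ∀ z, μ.map S (Set.Ioi z) = μ {ω | z < S ω} := fun z => by
    rw [Measure.map_apply hSmeas measurableSet_Ioi]; rfl
  simp only [hσ]
  have hmS : Measurable fun z : ℝ => μ {ω | z < S ω} :=
    Antitone.measurable fun a b h => measure_mono (fun ω (hω : b < S ω) => lt_of_le_of_lt h hω)
  have htot : ∫⁻ z in Set.Ioi 0, μ {ω | z < S ω} = 1 := by
    rw [← lintegral_eq_lintegral_meas_lt μ hSnn hSmeas.aemeasurable,
      ← ofReal_integral_eq_lintegral_ofReal hi hSnn, hES, ENNReal.ofReal_one]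
  have hsplit : (∫⁻ z in Set.Icc 0 u, μ {ω | z < S ω}) + ∫⁻ z in Set.Ioi u, μ {ω | z < S ω} = 1 := by
    rw [← htot, ← setLIntegral_congr (Ioc_ae_eq_Icc (a := (0:ℝ)) (b := u)),
      ← lintegral_union measurableSet_Ioi, Set.Ioc_union_Ioi_eq_Ioi hu]
    exact Set.disjoint_left.2 fun x hx hx' => absurd hx.2 (not_le.2 hx')
  have hle : ∫⁻ z in Set.Ioi u, μ {ω | z < S ω} ≤ 1 := by
    rw [← hsplit]; exact le_add_self
  have htail : μ {ω | u < R ω} = ∫⁻ z in Set.Ioi u, μ {ω | z < S ω} := by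
    have h := heq u hu
    rw [integral_toReal hmS.aemeasurable (ae_of_all _ fun z => measure_lt_top _ _)] at h
    exact (ENNReal.toReal_eq_toReal_iff' (measure_ne_top _ _)
      (ne_top_of_le_ne_top ENNReal.one_ne_top hle)).1 h
  rw [← htail] at hsplit
  have h2 : μ {ω | R ω ≤ u} + μ {ω | u < R ω} = 1 := by
    have := measure_add_measure_compl (μ := μ) (measurableSet_le hR (measurable_const (a := u)))
    rw [measure_univ] at this
    convert this using 3
    ext ω; simp
  rw [Measure.map_apply hR measurableSet_Iic]
  exact (ENNReal.add_left_inj (measure_ne_top μ {ω | u < R ω})).1 (h2.trans hsplit.symm)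

lemma map_Iio_zero {Ω : Type*} [MeasurableSpace Ω] {μ : Measure Ω} {Y : Ω → ℝ} (hY : Measurable Y) (h : ∀ᵐ ω ∂μ, 0 ≤ Y ω) :
    μ.map Y (Set.Iio 0) = 0 := by
  rw [Measure.map_apply hY measurableSet_Iio]
  rw [ae_iff] at h
  convert h using 2
  ext ω; simp

lemma tail_key (hSmeas : Measurable S) (hSnn : ∀ᵐ ω ∂μ, 0 ≤ S ω)
    (hES : ∫ ω, S ω ∂μ = 1)
    (hXmeas : ∀ j, Measurable (X j)) (hXnn : ∀ j, ∀ᵐ ω ∂μ, 0 ≤ X j ω)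
    (hindep : iIndepFun X μ) (hlaw : ∀ j, μ.map (X (j + 1)) = μ.map S)
    (heq : ∀ y : ℝ, 0 ≤ y →
      (μ {ω | y < X 0 ω}).toReal = ∫ z in Set.Ioi y, (μ {ω | z < S ω}).toReal)
    (t : ℝ) (n : ℕ) :
    μ {ω | ∑ j ∈ Finset.range (n + 1), X j ω ≤ t}
      + ∫⁻ x in Set.Icc 0 t, μ {ω | ∑ j ∈ Finset.range (n + 1), X (j + 1) ω ≤ x}
      = ∫⁻ x in Set.Icc 0 t, μ {ω | ∑ j ∈ Finset.range n, X (j + 1) ω ≤ x} := by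
  classical
  set W : Ω → ℝ := ∑ j ∈ (Finset.range n).image (· + 1), X j with hW
  have hWa : ∀ ω, W ω = ∑ j ∈ Finset.range n, X (j + 1) ω := fun ω => by
    rw [hW, Finset.sum_apply, Finset.sum_image (by simp)]
  have hWm : Measurable W := by
    have : W = fun ω => ∑ j ∈ Finset.range n, X (j + 1) ω := funext hWa
    rw [this]; fun_prop
  have hWnn : ∀ᵐ ω ∂μ, 0 ≤ W ω := by
    filter_upwards [ae_all_iff.2 hXnn] with ω h
    rw [hWa]; exact Finset.sum_nonneg fun j _ => h _
  have i0 : IndepFun W (X 0) μ := hindep.indepFun_finsetSum_of_notMem hXmeas (by simp)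
  have i1 : IndepFun W (X (n + 1)) μ := hindep.indepFun_finsetSum_of_notMem hXmeas (by simp)
  have : IsProbabilityMeasure (μ.map W) := Measure.isProbabilityMeasure_map hWm.aemeasurable
  have : IsProbabilityMeasure (μ.map S) := Measure.isProbabilityMeasure_map hSmeas.aemeasurable
  have : IsProbabilityMeasure (μ.map (X 0)) :=
    Measure.isProbabilityMeasure_map (hXmeas 0).aemeasurable
  have key := conv_key (μ.map (X 0)) (μ.map S) (μ.map W) (map_Iio_zero (hXmeas 0) (hXnn 0))
    (map_Iio_zero hSmeas hSnn) (map_Iio_zero hWm hWnn)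
    (law_zero hSmeas hSnn hES (hXmeas 0) heq) t
  rw [← i0.map_add_eq_map_conv_map hWm (hXmeas 0), ← hlaw n,
    ← i1.map_add_eq_map_conv_map hWm (hXmeas _),
    Measure.map_apply (hWm.add (hXmeas 0)) measurableSet_Iic] at key
  simp only [Measure.map_apply (hWm.add (hXmeas (n+1))) measurableSet_Iic,
    Measure.map_apply hWm measurableSet_Iic] at key
  convert key using 3
  · ext ω
    simp [Finset.sum_range_succ', hWa]
  · funext x
    congr 1
    ext ω
    simp [Finset.sum_range_succ, hWa]
  · congr 1
    ext ω
    simp [hWa]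

lemma chernoff (hSmeas : Measurable S)
    (hXmeas : ∀ j, Measurable (X j)) (hXnn : ∀ j, ∀ᵐ ω ∂μ, 0 ≤ X j ω)
    (hindep : iIndepFun X μ) (hlaw : ∀ j, μ.map (X (j + 1)) = μ.map S)
    (η : ℝ) (hη : 0 ≤ η) (x : ℝ) (hx : x ≤ 1) (n : ℕ) :
    μ {ω | ∑ j ∈ Finset.range n, X (j + 1) ω ≤ x}
      ≤ ENNReal.ofReal (Real.exp η * (∫ ω, Real.exp (-η * S ω) ∂μ) ^ n) := by
  have hi : iIndepFun (fun j => X (j + 1)) μ := hindep.precomp (g := fun j : ℕ => j + 1)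
    (fun a b h => by simpa using h)
  have hm : ∀ j, Measurable (X (j + 1)) := fun j => hXmeas _
  have hint : ∀ j, Integrable (fun ω => Real.exp (-η * X (j + 1) ω)) μ := fun j => by
    refine Integrable.of_bound (C := 1) (by fun_prop) ?_
    filter_upwards [hXnn (j + 1)] with ω h
    rw [Real.norm_eq_abs, Real.abs_exp]
    exact Real.exp_le_one_iff.2 (by nlinarith)
  have h1 := measure_le_le_exp_mul_mgf (μ := μ) (X := ∑ j ∈ Finset.range n, X (j + 1)) (t := -η) x
    (by linarith) (hi.integrable_exp_mul_sum hm (fun j _ => hint j))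
  rw [hi.mgf_sum hm] at h1
  have h2 : ∀ j, mgf (X (j + 1)) μ (-η) = ∫ ω, Real.exp (-η * S ω) ∂μ := fun j => by
    rw [mgf, ← integral_map (φ := X (j+1)) (f := fun y => Real.exp (-η * y)) (hm j).aemeasurable (by fun_prop), hlaw j,
      integral_map hSmeas.aemeasurable (by fun_prop)]
  simp only [h2, Finset.prod_const, Finset.card_range] at h1
  have h3 : μ {ω | ∑ j ∈ Finset.range n, X (j + 1) ω ≤ x}
      = ENNReal.ofReal (μ.real {ω | (∑ j ∈ Finset.range n, X (j + 1)) ω ≤ x}) := by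
    rw [ofReal_measureReal]; simp
  rw [h3]
  refine ENNReal.ofReal_le_ofReal (h1.trans ?_)
  gcongr
  nlinarith

lemma tail_bound (hSmeas : Measurable S) (hSnn : ∀ᵐ ω ∂μ, 0 ≤ S ω)
    (hES : ∫ ω, S ω ∂μ = 1)
    (hXmeas : ∀ j, Measurable (X j)) (hXnn : ∀ j, ∀ᵐ ω ∂μ, 0 ≤ X j ω)
    (hindep : iIndepFun X μ) (hlaw : ∀ j, μ.map (X (j + 1)) = μ.map S)
    (heq : ∀ y : ℝ, 0 ≤ y →
      (μ {ω | y < X 0 ω}).toReal = ∫ z in Set.Ioi y, (μ {ω | z < S ω}).toReal)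
    (t : ℝ) (ht1 : t ≤ 1) (η : ℝ) (hη : 0 ≤ η) (n : ℕ) :
    ∫⁻ x in Set.Icc 0 t, μ {ω | ∑ j ∈ Finset.range n, X (j + 1) ω ≤ x} ≤
      ENNReal.ofReal (Real.exp η * (∫ ω, Real.exp (-η * S ω) ∂μ) ^ n) * ENNReal.ofReal t ∧
    μ {ω | ∑ j ∈ Finset.range (n + 1), X j ω ≤ t} ≤
      ENNReal.ofReal (Real.exp η * (∫ ω, Real.exp (-η * S ω) ∂μ) ^ n) * ENNReal.ofReal t := by
  have h1 : ∫⁻ x in Set.Icc 0 t, μ {ω | ∑ j ∈ Finset.range n, X (j + 1) ω ≤ x} ≤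
      ENNReal.ofReal (Real.exp η * (∫ ω, Real.exp (-η * S ω) ∂μ) ^ n) * ENNReal.ofReal t := by
    refine (setLIntegral_mono measurable_const (fun x hx => chernoff hSmeas hXmeas hXnn hindep hlaw
      η hη x (hx.2.trans ht1) n)).trans ?_
    rw [setLIntegral_const, Real.volume_Icc, sub_zero]
  refine ⟨h1, le_trans ?_ h1⟩
  rw [← tail_key hSmeas hSnn hES hXmeas hXnn hindep hlaw heq t n]
  exact le_self_add

lemma tsum_tail (hSmeas : Measurable S) (hSnn : ∀ᵐ ω ∂μ, 0 ≤ S ω)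
    (hES : ∫ ω, S ω ∂μ = 1)
    (hXmeas : ∀ j, Measurable (X j)) (hXnn : ∀ j, ∀ᵐ ω ∂μ, 0 ≤ X j ω)
    (hindep : iIndepFun X μ) (hlaw : ∀ j, μ.map (X (j + 1)) = μ.map S)
    (heq : ∀ y : ℝ, 0 ≤ y →
      (μ {ω | y < X 0 ω}).toReal = ∫ z in Set.Ioi y, (μ {ω | z < S ω}).toReal)
    (t : ℝ) (ht1 : t ≤ 1) (η : ℝ) (hη : 0 ≤ η)
    (hq : ∫ ω, Real.exp (-η * S ω) ∂μ < 1) :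
    ∑' n, μ {ω | ∑ j ∈ Finset.range (n + 1), X j ω ≤ t} = ENNReal.ofReal t := by
  have hq0 : 0 ≤ ∫ ω, Real.exp (-η * S ω) ∂μ := integral_nonneg fun ω => (Real.exp_pos _).le
  have hpart : ∀ M : ℕ, ∑ n ∈ Finset.range M, μ {ω | ∑ j ∈ Finset.range (n + 1), X j ω ≤ t}
      + ∫⁻ x in Set.Icc 0 t, μ {ω | ∑ j ∈ Finset.range M, X (j + 1) ω ≤ x}
      = ENNReal.ofReal t := by
    intro M
    induction M with
    | zero =>
      simp only [Finset.range_zero, Finset.sum_empty, zero_add]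
      rw [setLIntegral_congr_fun (g := fun _ => 1) measurableSet_Icc]
      · simp
      · intro x hx
        simp [hx.1]
    | succ M ih =>
      rw [Finset.sum_range_succ, add_assoc,
        tail_key hSmeas hSnn hES hXmeas hXnn hindep hlaw heq t M, ih]
  refine le_antisymm ?_ ?_
  · rw [ENNReal.tsum_eq_iSup_nat]
    refine iSup_le fun M => ?_
    rw [← hpart M]
    exact le_self_add
  · have hlim : Filter.Tendsto (fun M : ℕ =>
        ∑' n, μ {ω | ∑ j ∈ Finset.range (n + 1), X j ω ≤ t} +
        ENNReal.ofReal (Real.exp η * (∫ ω, Real.exp (-η * S ω) ∂μ) ^ M) * ENNReal.ofReal t)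
        Filter.atTop
        (nhds (∑' n, μ {ω | ∑ j ∈ Finset.range (n + 1), X j ω ≤ t} +
          ENNReal.ofReal (Real.exp η * 0) * ENNReal.ofReal t)) := by
      refine Filter.Tendsto.add tendsto_const_nhds ?_
      refine ENNReal.Tendsto.mul_const ?_ (Or.inr ENNReal.ofReal_ne_top)
      refine ENNReal.tendsto_ofReal ?_
      exact (tendsto_pow_atTop_nhds_zero_of_lt_one hq0 hq).const_mul _
    simp only [mul_zero, ENNReal.ofReal_zero, zero_mul, add_zero] at hlim
    refine ge_of_tendsto' hlim fun M => (hpart M).symm.le.trans ?_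
    exact add_le_add (ENNReal.sum_le_tsum _)
      (tail_bound hSmeas hSnn hES hXmeas hXnn hindep hlaw heq t ht1 η hη M).1

lemma count_char {x : ℕ → ℝ} {t : ℝ} (ht : 0 ≤ t) (hx : ∀ j, 0 ≤ x j)
    (hM : ∃ M, t < ∑ j ∈ Finset.range (M + 1), x j) (n : ℕ) :
    n < renewalCount x t ↔ ∑ j ∈ Finset.range (n + 1), x j ≤ t := by
  have hmono : ∀ {a b : ℕ}, a ≤ b → ∑ j ∈ Finset.range a, x j ≤ ∑ j ∈ Finset.range b, x j :=
    fun {a b} h => Finset.sum_le_sum_of_subset_of_nonneg (Finset.range_mono h)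
      (fun j _ _ => hx j)
  obtain ⟨M, hM⟩ := hM
  have hb : BddAbove {n : ℕ | ∑ i ∈ Finset.range n, x i ≤ t} := by
    refine ⟨M, fun m hm => ?_⟩
    by_contra h
    have h1 : M + 1 ≤ m := by omega
    have h2 := hmono h1
    have h3 : ∑ i ∈ Finset.range m, x i ≤ t := hm
    linarith
  constructor
  · intro h
    have h1 : renewalCount x t ∈ {n : ℕ | ∑ i ∈ Finset.range n, x i ≤ t} :=
      Nat.sSup_mem ⟨0, by simpa using ht⟩ hb
    exact (hmono (Nat.succ_le_of_lt h)).trans h1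
  · intro h
    exact Nat.lt_of_succ_le (le_csSup hb h)

lemma lintegral_count {Ω : Type*} [MeasurableSpace Ω] {μ : Measure Ω}
    {X : ℕ → Ω → ℝ} (hXmeas : ∀ j, Measurable (X j)) (hXnn : ∀ j, ∀ᵐ ω ∂μ, 0 ≤ X j ω)
    (t : ℝ) (ht : 0 ≤ t)
    (hsum : ∑' n, μ {ω | ∑ j ∈ Finset.range (n + 1), X j ω ≤ t} ≠ ∞) (c : ℕ → ℝ≥0∞) :
    ∫⁻ ω, ∑ n ∈ Finset.range (renewalCount (fun j => X j ω) t), c n ∂μ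
      = ∑' n, c n * μ {ω | ∑ j ∈ Finset.range (n + 1), X j ω ≤ t} := by
  have hms : ∀ n, MeasurableSet {ω | ∑ j ∈ Finset.range (n + 1), X j ω ≤ t} := fun n =>
    measurableSet_le (by fun_prop) measurable_const
  have hae : ∀ᵐ ω ∂μ, ∀ n, n < renewalCount (fun j => X j ω) t ↔
      ∑ j ∈ Finset.range (n + 1), X j ω ≤ t := by
    filter_upwards [ae_all_iff.2 hXnn, ae_eventually_notMem hsum] with ω h1 h2 n
    obtain ⟨M, hM⟩ := h2.exists
    exact count_char ht h1 ⟨M, not_le.1 hM⟩ n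
  have : ∀ n, c n * μ {ω | ∑ j ∈ Finset.range (n + 1), X j ω ≤ t} =
      ∫⁻ ω, ({ω | ∑ j ∈ Finset.range (n + 1), X j ω ≤ t}).indicator (fun _ => c n) ω ∂μ :=
    fun n => by rw [lintegral_indicator_const (hms n)]
  simp only [this]
  rw [← lintegral_tsum fun n => (measurable_const.indicator (hms n)).aemeasurable]
  refine lintegral_congr_ae (hae.mono fun ω h => ?_)
  simp only
  rw [tsum_eq_sum (s := Finset.range (renewalCount (fun j => X j ω) t))]
  · refine Finset.sum_congr rfl fun n hn => ?_
    rw [Set.indicator_of_mem]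
    exact (h n).1 (Finset.mem_range.1 hn)
  · intro n hn
    rw [Set.indicator_of_notMem]
    exact fun h' => hn (Finset.mem_range.2 ((h n).2 h'))

lemma count_moments (hSmeas : Measurable S) (hSnn : ∀ᵐ ω ∂μ, 0 ≤ S ω)
    (hES : ∫ ω, S ω ∂μ = 1)
    (hXmeas : ∀ j, Measurable (X j)) (hXnn : ∀ j, ∀ᵐ ω ∂μ, 0 ≤ X j ω)
    (hindep : iIndepFun X μ) (hlaw : ∀ j, μ.map (X (j + 1)) = μ.map S)
    (heq : ∀ y : ℝ, 0 ≤ y →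
      (μ {ω | y < X 0 ω}).toReal = ∫ z in Set.Ioi y, (μ {ω | z < S ω}).toReal)
    (t : ℝ) (ht : 0 ≤ t) (ht1 : t ≤ 1) (η : ℝ) (hη : 0 ≤ η) (q : ℝ)
    (hqd : q = ∫ ω, Real.exp (-η * S ω) ∂μ) (hq : q < 1) :
    ∫⁻ ω, (renewalCount (fun j => X j ω) t : ℝ≥0∞) ∂μ = ENNReal.ofReal t ∧
    ∫⁻ ω, ENNReal.ofReal (Real.exp ((1 - q) / 4 * (renewalCount (fun j => X j ω) t : ℝ)) - 1) ∂μ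
      ≤ ENNReal.ofReal (t * Real.exp η) := by
  have hq0 : 0 ≤ q := hqd ▸ integral_nonneg fun ω => (Real.exp_pos _).le
  have hsum := tsum_tail hSmeas hSnn hES hXmeas hXnn hindep hlaw heq t ht1 η hη (hqd ▸ hq)
  have hne : ∑' n, μ {ω | ∑ j ∈ Finset.range (n + 1), X j ω ≤ t} ≠ ∞ :=
    hsum ▸ ENNReal.ofReal_ne_top
  constructor
  · have := lintegral_count hXmeas hXnn t ht hne (fun _ => 1)
    simpa [hsum] using this
  · set a := (1 - q) / 4 with ha
    have ha0 : 0 ≤ a := by rw [ha]; linarith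
    have hea1 : 1 ≤ Real.exp a := Real.one_le_exp ha0
    have hea : Real.exp a - 1 ≤ 2 * a := by
      have := Real.abs_exp_sub_one_le (x := a) (by rw [abs_of_nonneg ha0]; linarith)
      rw [abs_of_nonneg ha0] at this
      exact (le_abs_self _).trans this
    have hr0 : 0 ≤ Real.exp a * q := by positivity
    have hr : 1 - Real.exp a * q ≥ (1 - q) / 2 := by
      nlinarith
    have hr1 : Real.exp a * q < 1 := by linarith
    have h := lintegral_count hXmeas hXnn t ht hne
      (fun n => ENNReal.ofReal ((Real.exp a - 1) * Real.exp a ^ n))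
    have e : ∀ N : ℕ, ∑ n ∈ Finset.range N, ENNReal.ofReal ((Real.exp a - 1) * Real.exp a ^ n)
        = ENNReal.ofReal (Real.exp (a * N) - 1) := fun N => by
      rw [← ENNReal.ofReal_sum_of_nonneg, ← Finset.mul_sum, mul_geom_sum, mul_comm a,
        Real.exp_nat_mul]
      intro n _
      have : 0 ≤ Real.exp a - 1 := by linarith
      positivity
    simp only [e] at h
    rw [h]
    have hbd : ∀ n, ENNReal.ofReal ((Real.exp a - 1) * Real.exp a ^ n) *
        μ {ω | ∑ j ∈ Finset.range (n + 1), X j ω ≤ t} ≤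
        ENNReal.ofReal ((Real.exp a - 1) * (t * Real.exp η) * (Real.exp a * q) ^ n) := fun n => by
      refine (mul_le_mul_right (tail_bound hSmeas hSnn hES hXmeas hXnn hindep hlaw heq t ht1 η
        hη n).2 _).trans (le_of_eq ?_)
      rw [← hqd, ← ENNReal.ofReal_mul (by positivity), ← ENNReal.ofReal_mul]
      · congr 1
        rw [mul_pow]; ring
      · have : 0 ≤ Real.exp a - 1 := by linarith
        positivity
    refine (ENNReal.tsum_le_tsum hbd).trans ?_
    have hC : 0 ≤ (Real.exp a - 1) * (t * Real.exp η) := by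
      have : 0 ≤ Real.exp a - 1 := by linarith
      positivity
    rw [← ENNReal.ofReal_tsum_of_nonneg (fun n => by positivity)
      ((summable_geometric_of_lt_one hr0 hr1).mul_left _), tsum_mul_left,
      tsum_geometric_of_lt_one hr0 hr1]
    refine ENNReal.ofReal_le_ofReal ?_
    rw [← div_eq_mul_inv, div_le_iff₀ (by linarith), mul_comm]
    refine mul_le_mul_of_nonneg_left ?_ (by positivity)
    linarith

end Single

lemma exp_quad (x : ℝ) : Real.exp x ≤ 1 + x + x ^ 2 * Real.exp |x| := by
  have h1 : 1 ≤ Real.exp |x| := Real.one_le_exp (abs_nonneg x)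
  have hx2 : 0 ≤ x ^ 2 := sq_nonneg x
  rcases le_or_gt |x| 1 with h | h
  · have := (le_abs_self _).trans (Real.abs_exp_sub_one_sub_id_le h)
    nlinarith
  · rcases le_or_gt 0 x with h0 | h0
    · rw [abs_of_nonneg h0] at *
      have : Real.exp x ≤ x ^ 2 * Real.exp x :=
        le_mul_of_one_le_left (Real.exp_pos x).le (by nlinarith)
      linarith
    · rw [abs_of_neg h0] at *
      have : Real.exp x ≤ 1 := Real.exp_le_one_iff.2 h0.le
      nlinarith

lemma pt_bound (N : ℕ) (t b s : ℝ) (ht : 0 ≤ t) (ht1 : t ≤ 1) (hb : 0 < b) (hb1 : b ≤ 1 / 8)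
    (hs : |s| ≤ b) :
    Real.exp (s * (N - t)) ≤
      1 + s * (N - t) + s ^ 2 * (2 * t + 2 / b ^ 2 * (Real.exp (2 * b * N) - 1)) := by
  have h0 := exp_quad (s * (N - t))
  refine h0.trans ?_
  rw [mul_pow, mul_assoc]
  gcongr
  have h1 : Real.exp |s * (N - t)| ≤ Real.exp (b * |(N:ℝ) - t|) := by
    rw [abs_mul]; gcongr
  have h2 : ((N:ℝ) - t) ^ 2 * Real.exp |s * (N - t)| ≤
      ((N:ℝ) - t) ^ 2 * Real.exp (b * |(N:ℝ) - t|) := by gcongr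
  refine h2.trans ?_
  rcases Nat.eq_zero_or_pos N with rfl | hN
  · have e1 : Real.exp (b * t) ≤ 2 := by
      have h3 : 0 ≤ b * t := by positivity
      have h4 : b * t ≤ 1 / 8 := by nlinarith
      have := (le_abs_self _).trans
        (Real.abs_exp_sub_one_le (x := b * t) (by rw [abs_of_nonneg h3]; linarith))
      rw [abs_of_nonneg h3] at this
      linarith
    simp only [Nat.cast_zero, zero_sub, abs_neg, abs_of_nonneg ht, mul_zero, Real.exp_zero,
      sub_self, add_zero]
    have e2 : t ^ 2 ≤ t := by nlinarith
    have e3 := Real.exp_pos (b * t)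
    nlinarith
  · have hN1 : (1:ℝ) ≤ N := by exact_mod_cast hN
    rw [abs_of_nonneg (by linarith : 0 ≤ (N:ℝ) - t)]
    have hbN : 0 ≤ b * N := by positivity
    have e0 : Real.exp (b * ((N:ℝ) - t)) ≤ Real.exp (b * N) := by gcongr; linarith
    have e1 : ((N:ℝ) - t) ^ 2 ≤ (N:ℝ) ^ 2 := by gcongr <;> linarith
    have e2 := Real.quadratic_le_exp_of_nonneg hbN
    have e3 : Real.exp (2 * b * N) = Real.exp (b * N) * Real.exp (b * N) := by
      rw [← Real.exp_add]; congr 1; ring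
    have e5 : 1 ≤ Real.exp (b * N) := Real.one_le_exp hbN
    have e4 : (b * N) ^ 2 * Real.exp (b * N) ≤ 2 * (Real.exp (2 * b * N) - 1) := by
      rw [e3]; nlinarith
    have e6 : (N:ℝ) ^ 2 * Real.exp (b * N) ≤ 2 / b ^ 2 * (Real.exp (2 * b * N) - 1) := by
      rw [div_mul_eq_mul_div, le_div_iff₀ (by positivity)]
      nlinarith
    calc ((N:ℝ) - t) ^ 2 * Real.exp (b * ((N:ℝ) - t)) ≤ (N:ℝ) ^ 2 * Real.exp (b * N) := by gcongr
      _ ≤ _ := by linarith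

lemma mgf_bound {Ω : Type*} [MeasurableSpace Ω] {μ : Measure Ω} [IsProbabilityMeasure μ]
    {N : Ω → ℕ} (hN : Measurable N) (t b s E : ℝ) (ht : 0 ≤ t) (ht1 : t ≤ 1) (hb : 0 < b)
    (hb1 : b ≤ 1 / 8) (hs : |s| ≤ b) (hE : 1 ≤ E)
    (h1 : ∫⁻ ω, (N ω : ℝ≥0∞) ∂μ = ENNReal.ofReal t)
    (h2 : ∫⁻ ω, ENNReal.ofReal (Real.exp (2 * b * (N ω : ℝ)) - 1) ∂μ ≤ ENNReal.ofReal (t * E)) :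
    Integrable (fun ω => Real.exp (s * ((N ω : ℝ) - t))) μ ∧
    mgf (fun ω => (N ω : ℝ) - t) μ s ≤ Real.exp (4 * s ^ 2 * t * E / b ^ 2) := by
  have hNr : Measurable fun ω => (N ω : ℝ) := (measurable_of_countable _).comp hN
  have hg0 : ∀ ω, 0 ≤ Real.exp (2 * b * (N ω : ℝ)) - 1 := fun ω =>
    sub_nonneg.2 (Real.one_le_exp (by positivity))
  have e1 : ∀ ω, (N ω : ℝ≥0∞) = ENNReal.ofReal (N ω : ℝ) := fun ω => by simp
  simp only [e1] at h1
  have iN : Integrable (fun ω => (N ω : ℝ)) μ := by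
    refine ⟨hNr.aestronglyMeasurable, ?_⟩
    rw [hasFiniteIntegral_iff_ofReal (ae_of_all _ fun ω => by positivity), h1]
    exact ENNReal.ofReal_lt_top
  have ig : Integrable (fun ω => Real.exp (2 * b * (N ω : ℝ)) - 1) μ := by
    refine ⟨(by fun_prop), ?_⟩
    rw [hasFiniteIntegral_iff_ofReal (ae_of_all _ hg0)]
    exact h2.trans_lt ENNReal.ofReal_lt_top
  have vN : ∫ ω, (N ω : ℝ) ∂μ = t := by
    rw [integral_eq_lintegral_of_nonneg_ae (ae_of_all _ fun ω => by positivity)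
      hNr.aestronglyMeasurable, h1, ENNReal.toReal_ofReal ht]
  have vg : ∫ ω, (Real.exp (2 * b * (N ω : ℝ)) - 1) ∂μ ≤ t * E := by
    rw [integral_eq_lintegral_of_nonneg_ae (ae_of_all _ hg0) ig.1]
    exact ENNReal.toReal_le_of_le_ofReal (by positivity) h2
  have iB : Integrable (fun ω => 1 + s * ((N ω : ℝ) - t) +
      s ^ 2 * (2 * t + 2 / b ^ 2 * (Real.exp (2 * b * N ω) - 1))) μ := by
    refine ((integrable_const _).add ((iN.sub (integrable_const _)).const_mul _)).add ?_
    exact ((integrable_const _).add (ig.const_mul _)).const_mul _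
  have hpt := fun ω => pt_bound (N ω) t b s ht ht1 hb hb1 hs
  have iX : Integrable (fun ω => Real.exp (s * ((N ω : ℝ) - t))) μ := by
    refine iB.mono' (by fun_prop) (ae_of_all _ fun ω => ?_)
    rw [Real.norm_eq_abs, Real.abs_exp]
    exact hpt ω
  refine ⟨iX, ?_⟩
  have hle := integral_mono iX iB hpt
  have hval : ∫ ω, (1 + s * ((N ω : ℝ) - t) +
      s ^ 2 * (2 * t + 2 / b ^ 2 * (Real.exp (2 * b * N ω) - 1))) ∂μ
      = 1 + s ^ 2 * (2 * t + 2 / b ^ 2 * ∫ ω, (Real.exp (2 * b * (N ω : ℝ)) - 1) ∂μ) := by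
    rw [integral_add, integral_add, integral_const_mul, integral_sub iN (integrable_const _), vN,
      integral_const_mul, integral_add (integrable_const _) (ig.const_mul _), integral_const_mul]
    · simp
      left
      rw [integral_const_mul]
    · exact integrable_const _
    · exact (iN.sub (integrable_const _)).const_mul _
    · exact (integrable_const _).add ((iN.sub (integrable_const _)).const_mul _)
    · exact ((integrable_const _).add (ig.const_mul _)).const_mul _
  rw [hval] at hle
  refine hle.trans ?_
  have hfin : s ^ 2 * (2 * t + 2 / b ^ 2 * ∫ ω, (Real.exp (2 * b * (N ω : ℝ)) - 1) ∂μ)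
      ≤ 4 * s ^ 2 * t * E / b ^ 2 := by
    have h3 : 2 / b ^ 2 * ∫ ω, (Real.exp (2 * b * (N ω : ℝ)) - 1) ∂μ ≤ 2 / b ^ 2 * (t * E) := by
      gcongr
    have h4 : t ≤ t * E / b ^ 2 := by
      rw [le_div_iff₀ (by positivity)]
      have : b ^ 2 ≤ 1 := by nlinarith
      nlinarith
    have h5 : 4 * s ^ 2 * t * E / b ^ 2 = s ^ 2 * (2 * (t * E / b ^ 2) + 2 / b ^ 2 * (t * E)) := by
      ring
    rw [h5]
    gcongr
  linarith [Real.add_one_le_exp (4 * s ^ 2 * t * E / b ^ 2)]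

lemma rpow_le_cosh (p x : ℝ) (hp : 2 ≤ p) :
    |x| ^ p ≤ 6 * p ^ p * (Real.cosh x - 1) := by
  rw [← Real.cosh_abs x]
  have hx := abs_nonneg x
  set y := |x|
  have hq : y ^ 2 / 2 ≤ Real.cosh y - 1 := by
    have h1 := Real.quadratic_le_exp_of_nonneg hx
    have h2 : 2 * (Real.cosh y - 1) = (Real.exp (y/2) - Real.exp (-(y/2))) ^ 2 := by
      rw [Real.cosh_eq]
      have a1 : Real.exp y = Real.exp (y/2) ^ 2 := by
        rw [← Real.exp_nat_mul]; congr 1; push_cast; ring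
      have a2 : Real.exp (-y) = Real.exp (-(y/2)) ^ 2 := by
        rw [← Real.exp_nat_mul]; congr 1; push_cast; ring
      have a3 : Real.exp (y/2) * Real.exp (-(y/2)) = 1 := by rw [← Real.exp_add]; simp
      rw [a1, a2]; linear_combination 2 * a3
    have h3 := Real.self_le_sinh_iff.2 (show 0 ≤ y / 2 by positivity)
    rw [Real.sinh_eq] at h3
    nlinarith
  have hpp : 1 ≤ p ^ p := Real.one_le_rpow (by linarith) (by linarith)
  rcases le_or_gt y 1 with h | h
  · have h1 : y ^ p ≤ y ^ 2 := by
      rw [← Real.rpow_natCast]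
      exact Real.rpow_le_rpow_of_exponent_ge' hx h (by norm_num) (by exact_mod_cast hp)
    nlinarith [sq_nonneg y]
  · have h1 : y ^ p ≤ p ^ p * Real.exp y := by
      have h2 : y ≤ p * Real.exp (y / p) := by
        have := Real.add_one_le_exp (y / p)
        have h3 : y = p * (y / p) := by field_simp
        nlinarith
      calc y ^ p ≤ (p * Real.exp (y / p)) ^ p := by gcongr
        _ = p ^ p * Real.exp y := by
          rw [Real.mul_rpow (by linarith) (Real.exp_pos _).le, ← Real.exp_mul]
          congr 2; field_simp
    have h2 : Real.exp y ≤ 6 * (Real.cosh y - 1) := by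
      have h3 : Real.exp y ≤ 2 * Real.cosh y := by
        rw [Real.cosh_eq]; linarith [Real.exp_pos (-y)]
      nlinarith
    nlinarith

section Laplace

variable {Ω : Type*} [MeasurableSpace Ω] {μ : Measure Ω} [IsProbabilityMeasure μ]
  {S : Ω → ℝ}

lemma integrable_lap (hSmeas : Measurable S) (hSnn : ∀ᵐ ω ∂μ, 0 ≤ S ω) (η : ℝ) (hη : 0 < η) :
    Integrable (fun ω => Real.exp (-η * S ω)) μ := by
  refine Integrable.of_bound (C := 1) (by fun_prop) ?_
  filter_upwards [hSnn] with ω h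
  rw [Real.norm_eq_abs, Real.abs_exp]
  exact Real.exp_le_one_iff.2 (by nlinarith)

lemma lap_lt_one (hSmeas : Measurable S) (hSnn : ∀ᵐ ω ∂μ, 0 ≤ S ω)
    (hES : ∫ ω, S ω ∂μ = 1) (η : ℝ) (hη : 0 < η) :
    ∫ ω, Real.exp (-η * S ω) ∂μ < 1 := by
  have hi := integrable_lap hSmeas hSnn η hη
  have hnn : 0 ≤ᵐ[μ] fun ω => 1 - Real.exp (-η * S ω) := by
    filter_upwards [hSnn] with ω h
    exact sub_nonneg.2 (Real.exp_le_one_iff.2 (by nlinarith))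
  have hii : Integrable (fun ω => 1 - Real.exp (-η * S ω)) μ := (integrable_const _).sub hi
  have hv : ∫ ω, (1 - Real.exp (-η * S ω)) ∂μ = 1 - ∫ ω, Real.exp (-η * S ω) ∂μ := by
    rw [integral_sub (integrable_const _) hi]; simp
  have h0 : 0 ≤ ∫ ω, (1 - Real.exp (-η * S ω)) ∂μ := integral_nonneg_of_ae hnn
  rcases h0.lt_or_eq with h | h
  · linarith
  · exfalso
    have h1 := (integral_eq_zero_iff_of_nonneg_ae hnn hii).1 h.symm
    have h2 : S =ᵐ[μ] 0 := by
      filter_upwards [h1] with ω hω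
      have h3 : 1 - Real.exp (-η * S ω) = 0 := hω
      have h4 : -η * S ω = 0 := (Real.exp_eq_one_iff _).1 (by linarith)
      show S ω = 0
      rcases mul_eq_zero.1 h4 with h5 | h5
      · linarith
      · exact h5
    rw [integral_congr_ae h2] at hES
    simp at hES

lemma lap_compare (hSmeas : Measurable S) (hSnn : ∀ᵐ ω ∂μ, 0 ≤ S ω)
    (θ p : ℝ) (hθ : 0 < θ) (hp : 2 ≤ p) :
    1 - ∫ ω, Real.exp (-θ * S ω) ∂μ ≤ p * (1 - ∫ ω, Real.exp (-(θ / p) * S ω) ∂μ) := by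
  have hi := integrable_lap hSmeas hSnn θ hθ
  have hi' := integrable_lap hSmeas hSnn (θ / p) (by positivity)
  have hle : ∫ ω, (1 + p * (Real.exp (-(θ / p) * S ω) - 1)) ∂μ ≤ ∫ ω, Real.exp (-θ * S ω) ∂μ := by
    refine integral_mono ((integrable_const _).add ((hi'.sub (integrable_const _)).const_mul _)) hi
      fun ω => ?_
    have h := one_add_mul_self_le_rpow_one_add (s := Real.exp (-(θ / p) * S ω) - 1)
      (by linarith [Real.exp_pos (-(θ / p) * S ω)]) (p := p) (by linarith)
    rw [add_sub_cancel, ← Real.exp_mul] at h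
    have e : -(θ / p) * S ω * p = -θ * S ω := by field_simp
    rwa [e] at h
  have i1 : Integrable (fun ω => p * (Real.exp (-(θ / p) * S ω) - 1)) μ :=
    (hi'.sub (integrable_const _)).const_mul _
  rw [integral_add (integrable_const _) i1,
    integral_const_mul, integral_sub hi' (integrable_const _)] at hle
  simp at hle
  simp only [neg_mul]
  linarith

end Laplace

lemma final_ineq (k t θ p φ q : ℝ) (ht : 0 ≤ k * t) (hp : 2 ≤ p) (hθ : 0 < θ) (hφ : φ < 1)
    (hφ0 : 0 ≤ φ) (hq : q < 1) (hc : 1 - φ ≤ p * (1 - q)) :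
    ((((1 - q) / 8) / (4 * Real.sqrt (Real.exp (θ / p) * max 1 (k * t))))⁻¹) ^ p
      * (6 * p ^ p) * (k * t / (2 * max 1 (k * t))) ≤
    Real.exp θ * (10 ^ 5 * p ^ 4 / (1 - φ)) ^ (p + 2) * max (k * t) ((k * t) ^ (p / 2)) := by
  set m := max 1 (k * t) with hm
  have hm1 : 1 ≤ m := le_max_left _ _
  have hφ' : 0 < 1 - φ := by linarith
  have hq' : 0 < 1 - q := by linarith
  have hp0 : 0 < p := by linarith
  set G := 10 ^ 5 * p ^ 4 / (1 - φ) with hG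
  have hGb : 32 * p ^ 2 / (1 - φ) ≤ G := by
    rw [hG]
    gcongr ?_ / _
    have : 1 ≤ p ^ 2 := by nlinarith
    nlinarith [sq_nonneg (p ^ 2)]
  have hG3 : 3 ≤ G := by
    rw [hG, le_div_iff₀ hφ']
    have : 1 ≤ p ^ 4 := one_le_pow₀ (by linarith)
    nlinarith
  have hsE : Real.sqrt (Real.exp (θ / p) * m) = Real.exp (θ / p / 2) * m ^ (1 / 2 : ℝ) := by
    rw [Real.sqrt_mul (Real.exp_pos _).le, Real.sqrt_eq_rpow m, Real.exp_half]
  have h1 : (((1 - q) / 8) / (4 * Real.sqrt (Real.exp (θ / p) * m)))⁻¹ * p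
      ≤ G * (Real.exp (θ / p / 2) * m ^ (1 / 2 : ℝ)) := by
    rw [hsE]
    set Q := Real.exp (θ / p / 2) * m ^ (1 / 2 : ℝ) with hQ
    have hQ0 : 0 < Q := by positivity
    have e : ((1 - q) / 8 / (4 * Q))⁻¹ * p = 32 * p / (1 - q) * Q := by
      field_simp
      ring
    rw [e]
    gcongr
    refine le_trans ?_ hGb
    rw [div_le_div_iff₀ hq' hφ']
    nlinarith
  have h2 : ((((1 - q) / 8) / (4 * Real.sqrt (Real.exp (θ / p) * m)))⁻¹ * p) ^ p
      ≤ G ^ p * (Real.exp (θ / 2) * m ^ (p / 2)) := by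
    refine (Real.rpow_le_rpow (by positivity) h1 hp0.le).trans (le_of_eq ?_)
    rw [Real.mul_rpow (by linarith) (by positivity), Real.mul_rpow (by positivity) (by positivity),
      ← Real.exp_mul, ← Real.rpow_mul (by linarith)]
    congr 3
    · field_simp
    · ring
  rw [Real.mul_rpow (by positivity) hp0.le] at h2
  have h3 : m ^ (p / 2) * (k * t / m) ≤ max (k * t) ((k * t) ^ (p / 2)) := by
    rcases le_or_gt (k * t) 1 with h | h
    · have : m = 1 := max_eq_left h
      rw [this]; simp
    · have : m = k * t := max_eq_right h.le
      rw [this, div_self (by linarith), mul_one]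
      exact le_max_right _ _
  have h4 : Real.exp (θ / 2) ≤ Real.exp θ := by gcongr; linarith
  have h5 : 3 * G ^ p ≤ G ^ (p + 2) := by
    rw [Real.rpow_add (by linarith), mul_comm]
    gcongr
    have : G ^ (2:ℝ) = G ^ 2 := by exact_mod_cast Real.rpow_natCast G 2
    rw [this]; nlinarith
  have hG0 : 0 < G := by linarith
  calc _ = ((((1 - q) / 8) / (4 * Real.sqrt (Real.exp (θ / p) * m)))⁻¹ ^ p * p ^ p)
          * (3 * (k * t / m)) := by ring
    _ ≤ G ^ p * (Real.exp (θ / 2) * m ^ (p / 2)) * (3 * (k * t / m)) := by gcongr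
    _ = Real.exp (θ / 2) * (3 * G ^ p) * (m ^ (p / 2) * (k * t / m)) := by ring
    _ ≤ _ := by gcongr

end PCM

/-- Explicit bound on the `p`-th central moment of the pooled process `∑_{i=1}^k N_i(t)`
for `t ∈ [0,1]`, where the `N_i` are counting processes of i.i.d. equilibrium renewal
processes with renewal distribution `S`, `E[S] = 1`.  Here `ξ i 0` is the first
(equilibrium-distributed) interval of the `i`-th process and `ξ i (j+1)` its subsequent
intervals, distributed as `S`, all jointly independent. -/
theorem pooled_central_moment_small_time
    {Ω : Type*} [MeasurableSpace Ω] (μ : Measure Ω) [IsProbabilityMeasure μ]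
    (S : Ω → ℝ) (hSmeas : Measurable S) (hSnn : ∀ᵐ ω ∂μ, 0 ≤ S ω)
    (hES : ∫ ω, S ω ∂μ = 1)
    (ξ : ℕ → ℕ → Ω → ℝ)
    (hξmeas : ∀ i j, Measurable (ξ i j))
    (hξnn : ∀ i j, ∀ᵐ ω ∂μ, 0 ≤ ξ i j ω)
    (hindep : iIndepFun (fun q : ℕ × ℕ => ξ q.1 q.2) μ)
    (hlaw : ∀ i j, μ.map (ξ i (j + 1)) = μ.map S)
    (heq : ∀ i, ∀ y : ℝ, 0 ≤ y →
      (μ {ω | y < ξ i 0 ω}).toReal = ∫ z in Set.Ioi y, (μ {ω | z < S ω}).toReal) :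
    ∀ k : ℕ, 1 ≤ k → ∀ p : ℝ, 2 ≤ p → ∀ t : ℝ, 0 ≤ t → t ≤ 1 → ∀ θ : ℝ, 0 < θ →
      ∫⁻ ω, ENNReal.ofReal
          (|(∑ i ∈ Finset.range k, (renewalCount (fun j => ξ i j ω) t : ℝ)) - (k : ℝ) * t| ^ p) ∂μ
        ≤ ENNReal.ofReal (Real.exp θ
            * (10 ^ 5 * p ^ 4 / (1 - ∫ ω, Real.exp (-θ * S ω) ∂μ)) ^ (p + 2)
            * max ((k : ℝ) * t) (((k : ℝ) * t) ^ (p / 2))) := by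
  intro k _ p hp t ht ht1 θ hθ
  have hp0 : 0 < p := by linarith
  have hη : 0 < θ / p := by positivity
  obtain ⟨q, hqd⟩ : ∃ q, q = ∫ ω, Real.exp (-(θ / p) * S ω) ∂μ := ⟨_, rfl⟩
  have hq : q < 1 := hqd ▸ PCM.lap_lt_one hSmeas hSnn hES (θ / p) hη
  have hq0 : 0 ≤ q := hqd ▸ integral_nonneg fun ω => (Real.exp_pos _).le
  have hkt : 0 ≤ (k:ℝ) * t := by positivity
  obtain ⟨b, hb⟩ : ∃ b, b = (1 - q) / 8 := ⟨_, rfl⟩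
  obtain ⟨E, hE⟩ : ∃ E, E = Real.exp (θ / p) := ⟨_, rfl⟩
  obtain ⟨m, hm⟩ : ∃ m, m = max 1 ((k:ℝ) * t) := ⟨_, rfl⟩
  obtain ⟨s, hs⟩ : ∃ s, s = b / (4 * Real.sqrt (E * m)) := ⟨_, rfl⟩
  have hb0 : 0 < b := by rw [hb]; linarith
  have hb1 : b ≤ 1 / 8 := by rw [hb]; linarith
  have hE1 : 1 ≤ E := hE ▸ Real.one_le_exp hη.le
  have hm1 : 1 ≤ m := hm ▸ le_max_left _ _
  have hmk : (k:ℝ) * t ≤ m := hm ▸ le_max_right _ _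
  have hEm : 1 ≤ E * m := by nlinarith
  have hr1 : 1 ≤ Real.sqrt (E * m) := Real.one_le_sqrt.2 hEm
  have hs0 : 0 < s := by rw [hs]; positivity
  have hsb : s ≤ b := by
    rw [hs]; exact div_le_self hb0.le (by linarith)
  have hs2 : s ^ 2 = b ^ 2 / (16 * (E * m)) := by
    rw [hs, div_pow, mul_pow, Real.sq_sqrt (by linarith)]; norm_num
  -- the counts
  have hNm : ∀ i, Measurable fun ω => renewalCount (fun j => ξ i j ω) t := fun i =>
    (PCM.measurable_renewalCount t).comp (measurable_pi_iff.2 fun j => hξmeas i j)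
  have hmom : ∀ i, ∀ s', |s'| ≤ b →
      Integrable (fun ω => Real.exp (s' * ((renewalCount (fun j => ξ i j ω) t : ℝ) - t))) μ ∧
      mgf (fun ω => (renewalCount (fun j => ξ i j ω) t : ℝ) - t) μ s'
        ≤ Real.exp (4 * s' ^ 2 * t * E / b ^ 2) := fun i s' hs' => by
    have hi : iIndepFun (ξ i) μ :=
      hindep.precomp (g := fun j : ℕ => (i, j)) (fun a b h => by simpa using h)
    have hc := PCM.count_moments hSmeas hSnn hES (hξmeas i) (hξnn i) hi (hlaw i) (heq i) t ht ht1
      (θ / p) hη.le q hqd hq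
    refine PCM.mgf_bound (hNm i) t b s' E ht ht1 hb0 hb1 hs' hE1 hc.1 ?_
    have : 2 * b = (1 - q) / 4 := by rw [hb]; ring
    rw [this, hE]
    exact hc.2
  obtain ⟨X, hX⟩ : ∃ X : ℕ → Ω → ℝ,
    X = fun i ω => (renewalCount (fun j => ξ i j ω) t : ℝ) - t := ⟨_, rfl⟩
  have hXm : ∀ i, Measurable (X i) := fun i => by
    rw [hX]
    exact ((measurable_of_countable (fun n : ℕ => (n:ℝ))).comp (hNm i)).sub_const t
  have hXi : iIndepFun X μ := by
    have := (PCM.indep_curry μ ξ hξmeas hindep).comp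
      (fun _ x => (renewalCount x t : ℝ) - t)
      (fun _ => ((measurable_of_countable (fun n : ℕ => (n:ℝ))).comp
        (PCM.measurable_renewalCount t)).sub_const t)
    rw [hX]
    exact this
  obtain ⟨Y, hY⟩ : ∃ Y : Ω → ℝ, Y = ∑ i ∈ Finset.range k, X i := ⟨_, rfl⟩
  have hYv : ∀ ω, (∑ i ∈ Finset.range k, (renewalCount (fun j => ξ i j ω) t : ℝ)) - (k : ℝ) * t
      = Y ω := fun ω => by
    rw [hY, Finset.sum_apply, hX]
    simp
  simp only [hYv]
  obtain ⟨u, hu⟩ : ∃ u, u = (k:ℝ) * t / (4 * m) := ⟨_, rfl⟩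
  have hu0 : 0 ≤ u := by rw [hu]; positivity
  have hu1 : u ≤ 1 := by
    rw [hu, div_le_one (by positivity)]; linarith
  have hYmom : ∀ s', |s'| = s → Integrable (fun ω => Real.exp (s' * Y ω)) μ ∧
      ∫ ω, Real.exp (s' * Y ω) ∂μ ≤ Real.exp u := fun s' hs' => by
    have hle : |s'| ≤ b := hs'.le.trans hsb
    constructor
    · rw [hY]
      refine hXi.integrable_exp_mul_sum hXm fun i _ => ?_
      rw [hX]
      exact (hmom i s' hle).1
    · have h1 : mgf Y μ s' = ∏ i ∈ Finset.range k, mgf (X i) μ s' := by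
        rw [hY, hXi.mgf_sum hXm]
      change mgf Y μ s' ≤ _
      rw [h1]
      have h2 : ∏ i ∈ Finset.range k, mgf (X i) μ s' ≤
          ∏ i ∈ Finset.range k, Real.exp (4 * s' ^ 2 * t * E / b ^ 2) := by
        refine Finset.prod_le_prod (fun i _ => mgf_nonneg) fun i _ => ?_
        rw [hX]
        exact (hmom i s' hle).2
      refine h2.trans (le_of_eq ?_)
      rw [Finset.prod_const, Finset.card_range, ← Real.exp_nat_mul, ← sq_abs, hs', hs2, hu]
      congr 1
      field_simp
      norm_num
  have hp1 := hYmom s (abs_of_pos hs0)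
  have hp2 := hYmom (-s) (by rw [abs_neg, abs_of_pos hs0])
  have hcosh : ∀ ω, Real.cosh (s * Y ω) - 1
      = (Real.exp (s * Y ω) + Real.exp (-s * Y ω)) / 2 - 1 := fun ω => by
    rw [Real.cosh_eq, neg_mul]
  have hci : Integrable (fun ω => Real.cosh (s * Y ω) - 1) μ := by
    simp only [hcosh]
    exact ((hp1.1.add hp2.1).div_const 2).sub (integrable_const _)
  have hcv : ∫ ω, (Real.cosh (s * Y ω) - 1) ∂μ ≤ 2 * u := by
    simp only [hcosh]
    have i1 : Integrable (fun ω => (Real.exp (s * Y ω) + Real.exp (-s * Y ω)) / 2) μ :=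
      (hp1.1.add hp2.1).div_const 2
    rw [integral_sub i1 (integrable_const _), integral_div,
      integral_add hp1.1 hp2.1]
    have h3 := (le_abs_self _).trans
      (Real.abs_exp_sub_one_le (x := u) (by rw [abs_of_nonneg hu0]; exact hu1))
    rw [abs_of_nonneg hu0] at h3
    simp only [integral_const, probReal_univ, smul_eq_mul, mul_one]
    linarith [hp1.2, hp2.2]
  have hpt : ∀ ω, |Y ω| ^ p ≤ s⁻¹ ^ p * (6 * p ^ p) * (Real.cosh (s * Y ω) - 1) := fun ω => by
    have h1 := PCM.rpow_le_cosh p (s * Y ω) hp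
    have h2 : |Y ω| = s⁻¹ * |s * Y ω| := by
      rw [abs_mul, abs_of_pos hs0]; field_simp
    rw [h2, Real.mul_rpow (by positivity) (abs_nonneg _), mul_assoc]
    gcongr
  have hC0 : 0 ≤ s⁻¹ ^ p * (6 * p ^ p) := by positivity
  calc ∫⁻ ω, ENNReal.ofReal (|Y ω| ^ p) ∂μ
      ≤ ∫⁻ ω, ENNReal.ofReal (s⁻¹ ^ p * (6 * p ^ p) * (Real.cosh (s * Y ω) - 1)) ∂μ :=
        lintegral_mono fun ω => ENNReal.ofReal_le_ofReal (hpt ω)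
    _ = ENNReal.ofReal (∫ ω, s⁻¹ ^ p * (6 * p ^ p) * (Real.cosh (s * Y ω) - 1) ∂μ) := by
        rw [ofReal_integral_eq_lintegral_ofReal (hci.const_mul _)]
        exact ae_of_all _ fun ω => mul_nonneg hC0 (by linarith [Real.one_le_cosh (s * Y ω)])
    _ ≤ _ := by
        refine ENNReal.ofReal_le_ofReal ?_
        rw [integral_const_mul]
        refine (mul_le_mul_of_nonneg_left hcv hC0).trans ?_
        have hf := PCM.final_ineq k t θ p (∫ ω, Real.exp (-θ * S ω) ∂μ) q hkt hp hθ
          (PCM.lap_lt_one hSmeas hSnn hES θ hθ)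
          (integral_nonneg fun ω => (Real.exp_pos _).le) hq
          (hqd ▸ PCM.lap_compare hSmeas hSnn θ p hθ hp)
        rw [← hm, ← hE, ← hb, ← hs] at hf
        refine le_trans (le_of_eq ?_) hf
        rw [hu]
        congr 1
        field_simp
        ring
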